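/- arXiv:2512.06151 — 2 statements merged into one kernel-verified Lean document; each statement's English description precedes it below -/
import Mathlib

section
/- Let $J$ be a finite nonempty index set, $\nu > 0$, $\rho_{\max} > 0$, and let $\sigma \in \mathbb{R}^n$, and for each $j \in J$ let $o_j \in \mathbb{R}^n$ and $\rho_{o,j} \ge 0$. Set $\hat d_j = \|\sigma - o_j\| - \rho_{o,j}$ and $\rho = -\frac{1}{\nu}\ln\Big(e^{-\nu \rho_{\max}} + \sum_{j \in J} e^{-\nu \hat d_j}\Big)$. Then for every $j \in J$: (i) $\rho < \hat d_j$ and $\rho < \rho_{\max}$, and (ii) the closed balls $\mathcal{B}(\sigma, \rho) = \{x : \|x - \sigma\| \le \rho\}$ and $\mathcal{B}(o_j, \rho_{o,j}) = \{x : \|x - o_j\| \le \rho_{o,j}\}$ are disjoint. -/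
/-- With `d̂_j = ‖σ - o_j‖ - ρ_{o,j}` and tube radius
`ρ = -(1/ν) ln (e^{-ν ρ_max} + ∑_j e^{-ν d̂_j})`, for every `j` one has `ρ < d̂_j`,
`ρ < ρ_max`, and the closed balls `B(σ, ρ)` and `B(o_j, ρ_{o,j})` are disjoint. -/
theorem stmt_4 (n : ℕ) (J : Finset ℕ) (hJ : J.Nonempty) (ν ρmax : ℝ)
    (hν : 0 < ν) (hρmax : 0 < ρmax)
    (σ : EuclideanSpace ℝ (Fin n)) (o : ℕ → EuclideanSpace ℝ (Fin n))
    (ρo : ℕ → ℝ) (hρo : ∀ j ∈ J, 0 ≤ ρo j)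
    (dhat : ℕ → ℝ) (hdhat : ∀ j ∈ J, dhat j = ‖σ - o j‖ - ρo j)
    (ρ : ℝ)
    (hρ : ρ = -(1 / ν) * Real.log
      (Real.exp (-ν * ρmax) + ∑ j ∈ J, Real.exp (-ν * dhat j))) :
    ∀ j ∈ J, ρ < dhat j ∧ ρ < ρmax ∧
      Metric.closedBall σ ρ ∩ Metric.closedBall (o j) (ρo j) = ∅ := by
  intro j hj
  have key : ∀ d : ℝ, Real.exp (-ν * d) < Real.exp (-ν * ρmax) + ∑ j ∈ J, Real.exp (-ν * dhat j) →
      ρ < d := by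
    intro d hd
    have h1 := Real.log_lt_log (Real.exp_pos _) hd
    rw [Real.log_exp] at h1
    have h2 : ν * ρ = -Real.log
        (Real.exp (-ν * ρmax) + ∑ j ∈ J, Real.exp (-ν * dhat j)) := by
      rw [hρ]; field_simp
    have h3 : ν * ρ < ν * d := by linarith
    exact lt_of_mul_lt_mul_left h3 hν.le
  have hle : Real.exp (-ν * dhat j) ≤ ∑ j ∈ J, Real.exp (-ν * dhat j) :=
    Finset.single_le_sum (f := fun j => Real.exp (-ν * dhat j))
      (fun i _ => (Real.exp_pos _).le) hj
  have hd : ρ < dhat j := key _ (by linarith [Real.exp_pos (-ν * ρmax)])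
  refine ⟨hd, key _ (by linarith [Real.exp_pos (-ν * dhat j)]), ?_⟩
  rw [← Set.disjoint_iff_inter_eq_empty]
  apply Metric.closedBall_disjoint_closedBall
  rw [dist_eq_norm]
  linarith [hdhat j hj]
end

section
/- Let $t_c > 0$, $k_1 > 0$ with $k_1 t_c > 1$, $t_0 \in [0, t_c)$, and $\eta, \sigma_0 \in \mathbb{R}^n$. Then the function $\sigma(t) = \eta + (\sigma_0 - \eta)\left(\frac{t_c - t}{t_c - t_0}\right)^{k_1 t_c}$, extended by $\sigma(t_c) = \eta$, is differentiable on all of $[t_0, t_c]$ with $\dot\sigma(t) = -\frac{k_1 t_c}{t_c - t_0}(\sigma_0 - \eta)\left(\frac{t_c - t}{t_c - t_0}\right)^{k_1 t_c - 1}$ for $t \in [t_0, t_c)$ and $\dot\sigma(t_c) = 0$, and $\dot\sigma$ is continuous and bounded on $[t_0, t_c]$. -/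
/-- For `k₁ t_c > 1`, the STT center
`σ(t) = η + (σ₀ - η)((t_c - t)/(t_c - t₀))^(k₁ t_c)`, extended by `σ(t_c) = η`, is
differentiable on `[t₀, t_c]` with
`σ̇(t) = -(k₁ t_c/(t_c - t₀)) (σ₀ - η)((t_c - t)/(t_c - t₀))^(k₁ t_c - 1)` on `[t₀, t_c)`
and `σ̇(t_c) = 0`, and `σ̇` is continuous and bounded on `[t₀, t_c]`. -/
theorem stmt_16 (n : ℕ) (tc k1 t0 : ℝ) (htc : 0 < tc) (hk1 : 0 < k1)
    (hk1tc : 1 < k1 * tc) (ht0 : t0 ∈ Set.Ico (0 : ℝ) tc)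
    (η σ0 : EuclideanSpace ℝ (Fin n)) (σ σ' : ℝ → EuclideanSpace ℝ (Fin n))
    (hσ : ∀ t ∈ Set.Icc t0 tc,
      σ t = η + (((tc - t) / (tc - t0)) ^ (k1 * tc)) • (σ0 - η))
    (hσtc : σ tc = η)
    (hσ' : ∀ t ∈ Set.Icc t0 tc,
      σ' t = (-(k1 * tc / (tc - t0)) * ((tc - t) / (tc - t0)) ^ (k1 * tc - 1)) • (σ0 - η)) :
    (∀ t ∈ Set.Icc t0 tc, HasDerivWithinAt σ (σ' t) (Set.Icc t0 tc) t) ∧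
    σ' tc = 0 ∧
    ContinuousOn σ' (Set.Icc t0 tc) ∧
    ∃ M : ℝ, ∀ t ∈ Set.Icc t0 tc, ‖σ' t‖ ≤ M := by
  have hd : 0 < tc - t0 := sub_pos.mpr ht0.2
  have hcont : ContinuousOn σ' (Set.Icc t0 tc) := by
    have hc : Continuous fun t : ℝ =>
        (-(k1 * tc / (tc - t0)) * ((tc - t) / (tc - t0)) ^ (k1 * tc - 1)) • (σ0 - η) := by
      have h1 : Continuous fun t : ℝ => ((tc - t) / (tc - t0)) ^ (k1 * tc - 1) :=
        Continuous.rpow_const (by fun_prop) (fun t => Or.inr (by linarith))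
      exact (continuous_const.mul h1).smul continuous_const
    exact hc.continuousOn.congr hσ'
  refine ⟨?_, ?_, hcont, ?_⟩
  · intro t ht
    have h1 : HasDerivAt (fun t : ℝ => (tc - t) / (tc - t0)) (-1 / (tc - t0)) t :=
      ((hasDerivAt_id t).const_sub tc).div_const _
    have h2 := h1.rpow_const (p := k1 * tc) (Or.inr hk1tc.le)
    have h3 := (h2.smul_const (σ0 - η)).const_add η
    have h4 := h3.hasDerivWithinAt (s := Set.Icc t0 tc)
    have h5 := h4.congr hσ (hσ t ht)
    rw [hσ' t ht]
    have h6 : -(k1 * tc / (tc - t0)) * ((tc - t) / (tc - t0)) ^ (k1 * tc - 1)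
        = -1 / (tc - t0) * (k1 * tc) * ((tc - t) / (tc - t0)) ^ (k1 * tc - 1) := by
      ring
    rw [h6]
    exact h5
  · rw [hσ' tc ⟨ht0.2.le, le_rfl⟩]
    have : k1 * tc - 1 ≠ 0 := by linarith
    simp [Real.zero_rpow this]
  · exact isCompact_Icc.exists_bound_of_continuousOn hcont
end
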